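/- For two APs m ≠ n (with independent fading matrices D_m, D_n and independent pilot noises z_mk, z_nk, but common UE channels q_l for l ∈ P_k), the cross-AP coherent term satisfies: E[ h_mk^H ĥ_mk · ĥ_nk^H h_nk ] = (pτ)² · tr(R_AP,m R_mk Q_m) · tr(R_AP,n Q_n R_nk) · ( tr(R̃_mk) tr(R̃_nk) + tr(R̃_mk R̃_nk) + Σ_{l ∈ P_k \ {k}} tr(R̃_ml R̃_nk) ). -/

import Mathlib

open MeasureTheory ProbabilityTheory Matrix
open scoped ComplexOrder

/-- The standard complex Gaussian measure `CN(0,1)` on `ℂ`: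
the law of `(a + i b)/√2` with `a, b` independent standard real Gaussians. -/
noncomputable def stdCGauss : Measure ℂ :=
  Measure.map (fun p : ℝ × ℝ => ((p.1 : ℂ) + (p.2 : ℂ) * Complex.I) / (Real.sqrt 2 : ℂ))
    ((gaussianReal 0 1).prod (gaussianReal 0 1))

/-- The law of a standard complex Gaussian random vector with i.i.d. `CN(0,1)` coordinates. -/
noncomputable def stdCGaussPi (ι : Type) [Fintype ι] : Measure (ι → ℂ) :=
  Measure.pi fun _ => stdCGauss

/-- The law of a standard complex Gaussian random matrix with i.i.d. `CN(0,1)` entries. -/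
noncomputable def stdCGaussMat (ι κ : Type) [Fintype ι] [Fintype κ] : Measure (ι → κ → ℂ) :=
  Measure.pi fun _ => stdCGaussPi κ

/-- Entrywise expectation of a random complex matrix. -/
noncomputable def matExp {Ω n m : Type} [MeasurableSpace Ω] (μ : Measure Ω)
    (X : Ω → Matrix n m ℂ) : Matrix n m ℂ :=
  Matrix.of fun i j => ∫ ω, X ω i j ∂μ

/-- The AP–RIS channel matrix `W = √β̃ · R_RIS^{1/2} D R_AP^{1/2}` (with `S = R^{1/2}`). -/
noncomputable def Wmat {N L : ℕ} (βm : ℝ) (SRISm : Matrix (Fin N) (Fin N) ℂ)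
    (SAP : Matrix (Fin L) (Fin L) ℂ) (Dω : Fin N → Fin L → ℂ) :
    Matrix (Fin N) (Fin L) ℂ :=
  (Real.sqrt βm : ℂ) • (SRISm * Matrix.of Dω * SAP)

/-- The RIS–UE channel vector `q = √β̃ · R_RIS^{1/2} c` (with `S = R^{1/2}`). -/
noncomputable def qVec {N : ℕ} (βu : ℝ) (SRISu : Matrix (Fin N) (Fin N) ℂ)
    (cω : Fin N → ℂ) : Fin N → ℂ :=
  (Real.sqrt βu : ℂ) • (SRISu *ᵥ cω)

/-- The cascaded channel `h = Wᴴ Φ q`. -/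
noncomputable def hChan {N L : ℕ} (βm : ℝ) (SRISm : Matrix (Fin N) (Fin N) ℂ)
    (SAP : Matrix (Fin L) (Fin L) ℂ) (Φ : Matrix (Fin N) (Fin N) ℂ)
    (βu : ℝ) (SRISu : Matrix (Fin N) (Fin N) ℂ)
    (Dω : Fin N → Fin L → ℂ) (cω : Fin N → ℂ) : Fin L → ℂ :=
  (Wmat βm SRISm SAP Dω)ᴴ *ᵥ (Φ *ᵥ qVec βu SRISu cω)

/-- `R̃ = β̃_m β̃_u · R_RIS,m Φ R_RIS,u Φᴴ`. -/
noncomputable def Rtil {N : ℕ} (βm βu : ℝ) (RRISm Φ RRISu : Matrix (Fin N) (Fin N) ℂ) :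
    Matrix (Fin N) (Fin N) ℂ :=
  ((βm * βu : ℝ) : ℂ) • (RRISm * Φ * RRISu * Φᴴ)

theorem integral_pow_gaussianReal_le_four :
    (∫ x, x ^ 0 ∂gaussianReal 0 1 = 1) ∧ (∫ x, x ^ 1 ∂gaussianReal 0 1 = 0) ∧
    (∫ x, x ^ 2 ∂gaussianReal 0 1 = 1) ∧ (∫ x, x ^ 3 ∂gaussianReal 0 1 = 0) ∧
    (∫ x, x ^ 4 ∂gaussianReal 0 1 = 3) := by
  have key : ∀ n : ℕ, ∫ x, x ^ n ∂gaussianReal 0 1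
      = iteratedDeriv n (fun t : ℝ => Real.exp (t ^ 2 / 2)) 0 := by
    intro n
    have h := iteratedDeriv_mgf_zero (X := id) (μ := gaussianReal 0 1) (by simp) n
    rw [mgf_id_gaussianReal] at h
    simpa using h.symm
  have he : ∀ t : ℝ, HasDerivAt (fun t : ℝ => Real.exp (t ^ 2 / 2))
      (t * Real.exp (t ^ 2 / 2)) t := by
    intro t
    exact (((hasDerivAt_pow 2 t).div_const 2).exp).congr_deriv (by norm_num; ring)
  have d1 : iteratedDeriv 1 (fun t : ℝ => Real.exp (t ^ 2 / 2))
      = fun t => t * Real.exp (t ^ 2 / 2) := by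
    rw [iteratedDeriv_one]
    exact funext fun t => (he t).deriv
  have d2 : iteratedDeriv 2 (fun t : ℝ => Real.exp (t ^ 2 / 2))
      = fun t => (1 + t ^ 2) * Real.exp (t ^ 2 / 2) := by
    rw [iteratedDeriv_succ, d1]
    funext t
    exact (((hasDerivAt_id' t).mul (he t)).congr_deriv (by ring)).deriv
  have d3 : iteratedDeriv 3 (fun t : ℝ => Real.exp (t ^ 2 / 2))
      = fun t => (3 * t + t ^ 3) * Real.exp (t ^ 2 / 2) := by
    rw [iteratedDeriv_succ, d2]
    funext t
    exact ((((hasDerivAt_pow 2 t).const_add 1).mul (he t)).congr_deriv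
      (by norm_num; ring)).deriv
  have d4 : iteratedDeriv 4 (fun t : ℝ => Real.exp (t ^ 2 / 2))
      = fun t => (3 + 6 * t ^ 2 + t ^ 4) * Real.exp (t ^ 2 / 2) := by
    rw [iteratedDeriv_succ, d3]
    funext t
    exact ((((hasDerivAt_id' t).const_mul 3).add (hasDerivAt_pow 3 t)).mul (he t)
      |>.congr_deriv (by norm_num; ring)).deriv
  simp only [key, d1, d2, d3, d4]
  simp

instance : IsProbabilityMeasure stdCGauss :=
  Measure.isProbabilityMeasure_map (by fun_prop)

instance (ι : Type) [Fintype ι] : IsProbabilityMeasure (stdCGaussPi ι) := by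
  unfold stdCGaussPi; infer_instance

instance (ι κ : Type) [Fintype ι] [Fintype κ] : IsProbabilityMeasure (stdCGaussMat ι κ) := by
  unfold stdCGaussMat; infer_instance

theorem integrable_pow_gaussianReal (n : ℕ) :
    Integrable (fun x : ℝ => ((x : ℂ)) ^ n) (gaussianReal 0 1) := by
  have h := (memLp_id_gaussianReal (μ := 0) (v := 1) n).integrable_norm_pow'
  refine (integrable_norm_iff (by fun_prop)).1 ?_
  simpa using h

theorem integral_mixed_moment_stdCGauss (a b : ℕ) :
    ∫ z, star z ^ a * z ^ b ∂stdCGauss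
      = ∑ i ∈ Finset.range (b + 1), ∑ j ∈ Finset.range (a + 1),
        (((Real.sqrt 2 : ℂ)⁻¹) ^ (a + b) * Complex.I ^ (b - i) * (-Complex.I) ^ (a - j) *
          b.choose i * a.choose j) *
        (((∫ x, x ^ (i + j) ∂gaussianReal 0 1 : ℝ) : ℂ) *
          ((∫ x, x ^ ((b - i) + (a - j)) ∂gaussianReal 0 1 : ℝ) : ℂ)) := by
  have hexp : ∀ x y : ℝ,
      star (((x : ℂ) + (y : ℂ) * Complex.I) / (Real.sqrt 2 : ℂ)) ^ a *
        (((x : ℂ) + (y : ℂ) * Complex.I) / (Real.sqrt 2 : ℂ)) ^ b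
      = ∑ i ∈ Finset.range (b + 1), ∑ j ∈ Finset.range (a + 1),
        (((Real.sqrt 2 : ℂ)⁻¹) ^ (a + b) * Complex.I ^ (b - i) * (-Complex.I) ^ (a - j) *
          b.choose i * a.choose j) *
        ((x : ℂ) ^ (i + j) * (y : ℂ) ^ ((b - i) + (a - j))) := by
    intro x y
    have h1 : star (((x : ℂ) + (y : ℂ) * Complex.I) / (Real.sqrt 2 : ℂ))
        = (Real.sqrt 2 : ℂ)⁻¹ * ((x : ℂ) + (y : ℂ) * (-Complex.I)) := by
      simp [div_eq_inv_mul]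
    rw [h1, div_eq_inv_mul, mul_pow, mul_pow, add_pow, add_pow, mul_mul_mul_comm,
      ← pow_add, mul_comm (Finset.sum _ _), Finset.sum_mul_sum, Finset.mul_sum]
    refine Finset.sum_congr rfl fun i _ => ?_
    rw [Finset.mul_sum]
    refine Finset.sum_congr rfl fun j _ => ?_
    rw [mul_pow, mul_pow, pow_add (x : ℂ), pow_add (y : ℂ)]
    ring
  have hc : Continuous fun z : ℂ => star z ^ a * z ^ b := by fun_prop
  rw [stdCGauss, integral_map (by fun_prop) hc.aestronglyMeasurable]
  simp only [hexp]
  have hint : ∀ i j : ℕ, Integrable (fun w : ℝ × ℝ => (w.1 : ℂ) ^ i * (w.2 : ℂ) ^ j)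
      ((gaussianReal 0 1).prod (gaussianReal 0 1)) := fun i j =>
    (integrable_pow_gaussianReal i).mul_prod (integrable_pow_gaussianReal j)
  have hval : ∀ i j : ℕ, ∫ w : ℝ × ℝ, (w.1 : ℂ) ^ i * (w.2 : ℂ) ^ j
      ∂((gaussianReal 0 1).prod (gaussianReal 0 1))
      = ((∫ x, x ^ i ∂gaussianReal 0 1 : ℝ) : ℂ) * ((∫ x, x ^ j ∂gaussianReal 0 1 : ℝ) : ℂ) := by
    intro i j
    rw [integral_prod_mul (fun x : ℝ => (x : ℂ) ^ i) (fun x : ℝ => (x : ℂ) ^ j),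
      ← integral_complex_ofReal, ← integral_complex_ofReal]
    simp
  rw [integral_finsetSum _ fun i _ => integrable_finsetSum _ fun j _ => (hint _ _).const_mul _]
  refine Finset.sum_congr rfl fun i _ => ?_
  rw [integral_finsetSum _ fun j _ => (hint _ _).const_mul _]
  refine Finset.sum_congr rfl fun j _ => ?_
  rw [integral_const_mul, hval]

theorem integral_moment_stdCGauss {a b : ℕ} (ha : a ≤ 2) (hb : b ≤ 2) :
    ∫ z, star z ^ a * z ^ b ∂stdCGauss = if a = b then (a.factorial : ℂ) else 0 := by
  obtain ⟨m0, m1, m2, m3, m4⟩ := integral_pow_gaussianReal_le_four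
  have hs : ((Real.sqrt 2 : ℂ)) ^ 2 = 2 := by
    rw [← Complex.ofReal_pow, Real.sq_sqrt (by norm_num)]; norm_num
  have hs4 : ((Real.sqrt 2 : ℂ)) ^ 4 = 4 := by
    rw [show 4 = 2 * 2 from rfl, pow_mul, hs]; norm_num
  rw [integral_mixed_moment_stdCGauss]
  interval_cases a <;> interval_cases b <;>
    simp only [Finset.sum_range_succ, Finset.sum_range_zero, Nat.reduceAdd, Nat.reduceSub,
      m0, m1, m2, m3, m4, inv_pow, hs, hs4] <;>
    norm_num [Nat.choose]
  · linear_combination (-1 / 2 : ℂ) * Complex.I_mul_I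
  · linear_combination (-1 : ℂ) * Complex.I_mul_I

theorem integral_prod_stdCGaussMat {ι κ : Type} [Fintype ι] [Fintype κ] (g : ι → κ → ℂ → ℂ) :
    ∫ x, ∏ i, ∏ j, g i j (x i j) ∂stdCGaussMat ι κ = ∏ i, ∏ j, ∫ z, g i j z ∂stdCGauss := by
  rw [stdCGaussMat, integral_fintype_prod_eq_prod (f := fun i (y : κ → ℂ) => ∏ j, g i j (y j))]
  refine Finset.prod_congr rfl fun i _ => ?_
  rw [stdCGaussPi, integral_fintype_prod_eq_prod]

theorem integral_coord_stdCGaussPi {ι : Type} [Fintype ι] (j : ι) :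
    ∫ x, x j ∂stdCGaussPi ι = 0 := by
  have h := (measurePreserving_eval (fun _ : ι => stdCGauss) j).map_eq
  have h0 := integral_moment_stdCGauss (a := 0) (b := 1) (by norm_num) (by norm_num)
  rw [← h, integral_map (measurable_pi_apply j).aemeasurable (by fun_prop)] at h0
  simpa [stdCGaussPi] using h0

/-- A complex random variable all of whose absolute moments are finite. -/
def HasAllMoments {α : Type*} [MeasurableSpace α] (ν : Measure α) (f : α → ℂ) : Prop :=
  ∀ p : NNReal, MemLp f p ν

namespace HasAllMoments

variable {α : Type*} [MeasurableSpace α] {ν : Measure α} {f g : α → ℂ}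

theorem integrable (hf : HasAllMoments ν f) : Integrable f ν :=
  memLp_one_iff_integrable.1 (by simpa using hf 1)

theorem const [IsFiniteMeasure ν] (a : ℂ) : HasAllMoments ν fun _ => a := fun _ => memLp_const a

theorem mul (hf : HasAllMoments ν f) (hg : HasAllMoments ν g) :
    HasAllMoments ν fun x => f x * g x := by
  intro p
  have : ENNReal.HolderTriple ((2 * p : NNReal) : ENNReal) ((2 * p : NNReal) : ENNReal) p := by
    refine ⟨?_⟩
    rw [ENNReal.coe_mul, ENNReal.mul_inv (by simp) (by simp), ← add_mul]
    simp [ENNReal.inv_two_add_inv_two]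
  exact (hg (2 * p)).mul' (hf (2 * p))

theorem star (hf : HasAllMoments ν f) : HasAllMoments ν fun x => star (f x) :=
  fun p => (hf p).star

theorem sum {ι : Type*} (s : Finset ι) {F : ι → α → ℂ} (h : ∀ i ∈ s, HasAllMoments ν (F i)) :
    HasAllMoments ν fun x => ∑ i ∈ s, F i x :=
  fun p => memLp_finsetSum s fun i hi => h i hi p

theorem comp_measurePreserving {β : Type*} [MeasurableSpace β] {η : Measure β} {φ : β → α}
    (hf : HasAllMoments ν f) (hφ : MeasurePreserving φ η ν) : HasAllMoments η (f ∘ φ) :=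
  fun p => (hf p).comp_measurePreserving hφ

end HasAllMoments

theorem hasAllMoments_stdCGauss : HasAllMoments stdCGauss fun z => z := by
  intro p
  rw [stdCGauss]
  refine (memLp_map_measure_iff (by fun_prop) (by fun_prop)).2 ?_
  have h := memLp_id_gaussianReal (μ := 0) (v := 1) p
  have h1 : MemLp (fun w : ℝ × ℝ => (w.1 : ℂ)) p
      ((gaussianReal 0 1).prod (gaussianReal 0 1)) :=
    (h.comp_measurePreserving measurePreserving_fst).ofReal
  have h2 : MemLp (fun w : ℝ × ℝ => (w.2 : ℂ)) p
      ((gaussianReal 0 1).prod (gaussianReal 0 1)) :=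
    (h.comp_measurePreserving measurePreserving_snd).ofReal
  have h3 := (h1.add (h2.mul_const Complex.I)).mul_const (Real.sqrt 2 : ℂ)⁻¹
  exact h3

theorem hasAllMoments_coord_stdCGaussPi {ι : Type} [Fintype ι] (i : ι) :
    HasAllMoments (stdCGaussPi ι) fun x => x i :=
  hasAllMoments_stdCGauss.comp_measurePreserving
    (measurePreserving_eval (fun _ : ι => stdCGauss) i)

theorem hasAllMoments_coord_stdCGaussMat {ι κ : Type} [Fintype ι] [Fintype κ] (i : ι) (j : κ) :
    HasAllMoments (stdCGaussMat ι κ) fun x => x i j :=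
  (hasAllMoments_coord_stdCGaussPi j).comp_measurePreserving
    (measurePreserving_eval (fun _ : ι => stdCGaussPi κ) i)

theorem integral_monomial_stdCGaussMat {ι κ : Type} [Fintype ι] [Fintype κ]
    (a b : ι × κ → ℕ) (ha : ∀ p, a p ≤ 2) (hb : ∀ p, b p ≤ 2) :
    ∫ x, ∏ p : ι × κ, star (x p.1 p.2) ^ a p * x p.1 p.2 ^ b p ∂stdCGaussMat ι κ
      = ∏ p, if a p = b p then ((a p).factorial : ℂ) else 0 := by
  simp only [Fintype.prod_prod_type]
  rw [integral_prod_stdCGaussMat fun i j z => star z ^ a (i, j) * z ^ b (i, j)]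
  simp only [integral_moment_stdCGauss (ha _) (hb _)]

theorem integral_two_coord_stdCGaussMat {ι κ : Type} [Fintype ι] [Fintype κ] [DecidableEq ι]
    [DecidableEq κ] (P Q : ι × κ) :
    ∫ x, star (x P.1 P.2) * x Q.1 Q.2 ∂stdCGaussMat ι κ = if P = Q then 1 else 0 := by
  have h := integral_monomial_stdCGaussMat (fun p => if P = p then 1 else 0)
    (fun p => if Q = p then 1 else 0) (fun p => by split_ifs <;> simp)
    (fun p => by split_ifs <;> simp)
  simp only [Finset.prod_mul_distrib, Finset.prod_pow_boole, Finset.mem_univ, if_true] at h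
  rw [h]
  by_cases hPQ : P = Q
  · subst hPQ
    rw [if_pos rfl]
    refine Finset.prod_eq_one fun p _ => ?_
    split_ifs <;> simp_all
  · rw [if_neg hPQ]
    exact Finset.prod_eq_zero (Finset.mem_univ P) (by simp [Ne.symm hPQ])

theorem integral_four_coord_stdCGaussMat {ι κ : Type} [Fintype ι] [Fintype κ] [DecidableEq ι]
    [DecidableEq κ] (P Q R S : ι × κ) :
    ∫ x, star (x P.1 P.2) * x Q.1 Q.2 * (star (x R.1 R.2) * x S.1 S.2) ∂stdCGaussMat ι κ
      = (if P = Q then 1 else 0) * (if R = S then 1 else 0)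
        + (if P = S then 1 else 0) * (if R = Q then 1 else 0) := by
  have h := integral_monomial_stdCGaussMat
    (fun p => (if P = p then 1 else 0) + (if R = p then 1 else 0))
    (fun p => (if Q = p then 1 else 0) + (if S = p then 1 else 0))
    (fun p => by split_ifs <;> simp)
    (fun p => by split_ifs <;> simp)
  simp only [pow_add, Finset.prod_mul_distrib, Finset.prod_pow_boole, Finset.mem_univ,
    if_true] at h
  have hre : ∀ x : ι → κ → ℂ, star (x P.1 P.2) * x Q.1 Q.2 * (star (x R.1 R.2) * x S.1 S.2)
      = star (x P.1 P.2) * star (x R.1 R.2) * (x Q.1 Q.2 * x S.1 S.2) := fun x => by ring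
  simp only [hre]
  rw [h]
  by_cases hC : (P = Q ∧ R = S) ∨ (P = S ∧ R = Q)
  · have hrhs : (if P = Q then (1 : ℂ) else 0) * (if R = S then 1 else 0)
        + (if P = S then 1 else 0) * (if R = Q then 1 else 0) = if P = R then 2 else 1 := by
      rcases hC with ⟨rfl, rfl⟩ | ⟨rfl, rfl⟩ <;> by_cases hPR : P = R <;>
        simp [hPR, eq_comm] <;> norm_num
    have hab : ∀ p, (if P = p then 1 else 0) + (if R = p then 1 else 0)
        = (if Q = p then 1 else 0) + (if S = p then 1 else 0) := by
      intro p
      rcases hC with ⟨rfl, rfl⟩ | ⟨rfl, rfl⟩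
      · rfl
      · exact add_comm _ _
    simp only [hrhs, hab, if_true]
    simp only [← hab]
    by_cases hPR : P = R
    · subst hPR
      rw [if_pos rfl, Finset.prod_eq_single P] <;> simp +contextual [eq_comm]
    · rw [if_neg hPR]
      refine Finset.prod_eq_one fun p _ => ?_
      split_ifs <;> simp_all
  · have hrhs : (if P = Q then (1 : ℂ) else 0) * (if R = S then 1 else 0)
        + (if P = S then 1 else 0) * (if R = Q then 1 else 0) = 0 := by
      split_ifs <;> simp_all
    have hne : ∃ p, (if P = p then 1 else 0) + (if R = p then 1 else 0)
        ≠ (if Q = p then 1 else 0) + (if S = p then 1 else 0) := by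
      by_contra! hall
      refine hC ?_
      have hP : Q = P ∨ S = P := by
        have := hall P
        by_contra! hc
        simp [hc.1, hc.2] at this
      rcases hP with rfl | rfl
      · have hR := hall R
        by_cases hS : S = R <;> simp_all
      · have hR := hall R
        by_cases hQ : Q = R <;> simp_all [add_comm]
    obtain ⟨p, hp⟩ := hne
    rw [hrhs]
    exact Finset.prod_eq_zero (Finset.mem_univ p) (if_neg hp)

/-- Isserlis' formula for linear forms in the entries of a standard complex Gaussian matrix. -/
theorem integral_four_linear_stdCGaussMat {ι κ : Type} [Fintype ι] [Fintype κ]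
    (v w v' w' : ι × κ → ℂ) :
    ∫ x, star (∑ p, v p * x p.1 p.2) * (∑ p, w p * x p.1 p.2) *
        (star (∑ p, v' p * x p.1 p.2) * ∑ p, w' p * x p.1 p.2) ∂stdCGaussMat ι κ
      = (∑ p, star (v p) * w p) * (∑ p, star (v' p) * w' p)
        + (∑ p, star (v p) * w' p) * ∑ p, star (v' p) * w p := by
  classical
  have hX : ∀ p : ι × κ, HasAllMoments (stdCGaussMat ι κ) fun x => x p.1 p.2 :=
    fun p => hasAllMoments_coord_stdCGaussMat _ _
  have hint : ∀ P Q R S : ι × κ, Integrable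
      (fun x : ι → κ → ℂ => star (v P) * w Q * (star (v' R) * w' S) *
        (star (x P.1 P.2) * x Q.1 Q.2 * (star (x R.1 R.2) * x S.1 S.2))) (stdCGaussMat ι κ) :=
    fun P Q R S =>
      (((hX P).star.mul (hX Q)).mul ((hX R).star.mul (hX S))).integrable.const_mul _
  have hexp : ∀ x : ι → κ → ℂ, star (∑ p, v p * x p.1 p.2) * (∑ p, w p * x p.1 p.2) *
        (star (∑ p, v' p * x p.1 p.2) * ∑ p, w' p * x p.1 p.2)
      = ∑ P, ∑ Q, ∑ R, ∑ S, star (v P) * w Q * (star (v' R) * w' S) *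
        (star (x P.1 P.2) * x Q.1 Q.2 * (star (x R.1 R.2) * x S.1 S.2)) := by
    intro x
    rw [star_sum, star_sum, Finset.sum_mul_sum, Finset.sum_mul_sum, Finset.sum_mul]
    refine Finset.sum_congr rfl fun P _ => ?_
    rw [Finset.sum_mul]
    refine Finset.sum_congr rfl fun Q _ => ?_
    rw [Finset.mul_sum]
    refine Finset.sum_congr rfl fun R _ => ?_
    rw [Finset.mul_sum]
    refine Finset.sum_congr rfl fun S _ => ?_
    simp only [star_mul']
    ring
  simp only [hexp]
  rw [integral_finsetSum _ fun P _ => integrable_finsetSum _ fun Q _ =>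
    integrable_finsetSum _ fun R _ => integrable_finsetSum _ fun S _ => hint P Q R S]
  simp_rw [integral_finsetSum _ fun Q _ =>
    integrable_finsetSum _ fun R _ => integrable_finsetSum _ fun S _ => hint _ Q R S,
    integral_finsetSum _ fun R _ => integrable_finsetSum _ fun S _ => hint _ _ R S,
    integral_finsetSum _ fun S _ => hint _ _ _ S, integral_const_mul,
    integral_four_coord_stdCGaussMat, mul_add, Finset.sum_add_distrib]
  congr 1
  · simp [Finset.sum_mul_sum]
  · have : ∀ P Q R S : ι × κ, star (v P) * w Q * (star (v' R) * w' S) *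
        ((if P = S then 1 else 0) * if R = Q then 1 else 0)
        = if P = S then (if R = Q then star (v P) * w Q * (star (v' R) * w' S) else 0) else 0 := by
      intros
      split_ifs <;> simp
    simp only [this, Finset.sum_ite_eq, Finset.sum_ite_eq', Finset.mem_univ, if_true,
      Finset.sum_mul_sum]
    refine Finset.sum_congr rfl fun P _ => Finset.sum_congr rfl fun Q _ => ?_
    ring

theorem hasAllMoments_mulVec_stdCGaussMat {ι κ n : Type} [Fintype ι] [Fintype κ]
    (G : Matrix n κ ℂ) (l : ι) (r : n) :
    HasAllMoments (stdCGaussMat ι κ) fun c => (G *ᵥ c l) r :=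
  HasAllMoments.sum _ fun a _ =>
    (HasAllMoments.const _).mul (hasAllMoments_coord_stdCGaussMat l a)

theorem integral_four_mulVec_stdCGaussMat {K κ n : Type} [Fintype K] [Fintype κ]
    (G : K → Matrix n κ ℂ) (Pk : Finset K) {k : K} (hk : k ∈ Pk) (r s r' s' : n) :
    ∫ c, star ((G k *ᵥ c k) r) * (∑ l ∈ Pk, (G l *ᵥ c l) s) *
        (star (∑ l ∈ Pk, (G l *ᵥ c l) r') * (G k *ᵥ c k) s') ∂stdCGaussMat K κ
      = (G k * (G k)ᴴ) s r * (G k * (G k)ᴴ) s' r'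
        + (G k * (G k)ᴴ) s' r * ∑ l ∈ Pk, (G l * (G l)ᴴ) s r' := by
  classical
  have h1 : ∀ (c : K → κ → ℂ) (i : n), (G k *ᵥ c k) i
      = ∑ p : K × κ, (if p.1 = k then G k i p.2 else 0) * c p.1 p.2 := by
    intro c i
    rw [Fintype.sum_prod_type, Finset.sum_eq_single k]
    · simp [mulVec, dotProduct]
    · intro b _ hb
      simp [hb]
    · simp
  have h2 : ∀ (c : K → κ → ℂ) (i : n), ∑ l ∈ Pk, (G l *ᵥ c l) i
      = ∑ p : K × κ, (if p.1 ∈ Pk then G p.1 i p.2 else 0) * c p.1 p.2 := by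
    intro c i
    rw [Fintype.sum_prod_type, ← Finset.sum_subset (Finset.subset_univ Pk)]
    · refine Finset.sum_congr rfl fun l hl => ?_
      simp [mulVec, dotProduct, hl]
    · intro l _ hl
      simp [hl]
  simp only [h1, h2]
  rw [integral_four_linear_stdCGaussMat]
  have e1 : ∀ i j : n, ∑ p : K × κ, star (if p.1 = k then G k i p.2 else 0) *
      (if p.1 ∈ Pk then G p.1 j p.2 else 0) = (G k * (G k)ᴴ) j i := by
    intro i j
    rw [Fintype.sum_prod_type, Finset.sum_eq_single k]
    · simp [Matrix.mul_apply, hk, mul_comm]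
    · intro b _ hb
      simp [hb]
    · simp
  have e2 : ∀ i j : n, ∑ p : K × κ, star (if p.1 ∈ Pk then G p.1 i p.2 else 0) *
      (if p.1 = k then G k j p.2 else 0) = (G k * (G k)ᴴ) j i := by
    intro i j
    rw [Fintype.sum_prod_type, Finset.sum_eq_single k]
    · simp [Matrix.mul_apply, hk, mul_comm]
    · intro b _ hb
      simp [hb]
    · simp
  have e3 : ∀ i j : n, ∑ p : K × κ, star (if p.1 = k then G k i p.2 else 0) *
      (if p.1 = k then G k j p.2 else 0) = (G k * (G k)ᴴ) j i := by
    intro i j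
    rw [Fintype.sum_prod_type, Finset.sum_eq_single k]
    · simp [Matrix.mul_apply, mul_comm]
    · intro b _ hb
      simp [hb]
    · simp
  have e4 : ∀ i j : n, ∑ p : K × κ, star (if p.1 ∈ Pk then G p.1 i p.2 else 0) *
      (if p.1 ∈ Pk then G p.1 j p.2 else 0) = ∑ l ∈ Pk, (G l * (G l)ᴴ) j i := by
    intro i j
    rw [Fintype.sum_prod_type, ← Finset.sum_subset (Finset.subset_univ Pk)]
    · refine Finset.sum_congr rfl fun l hl => ?_
      simp [Matrix.mul_apply, hl, mul_comm]
    · intro l _ hl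
      simp [hl]
  rw [e1, e2, e3, e4]

theorem integral_mul_conjTranspose_stdCGaussMat {n m : Type} [Fintype n] [Fintype m]
    [DecidableEq n] (B : Matrix m m ℂ) (a d : n) :
    ∫ D, (Matrix.of D * B * (Matrix.of D)ᴴ) a d ∂stdCGaussMat n m
      = if a = d then B.trace else 0 := by
  classical
  have hX : ∀ (i : n) (j : m), HasAllMoments (stdCGaussMat n m) fun x => x i j :=
    hasAllMoments_coord_stdCGaussMat
  have hexp : ∀ D : n → m → ℂ, (Matrix.of D * B * (Matrix.of D)ᴴ) a d
      = ∑ c, ∑ b, B b c * (star (D d c) * D a b) := by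
    intro D
    simp only [Matrix.mul_apply, conjTranspose_apply, of_apply, Finset.sum_mul]
    exact Finset.sum_congr rfl fun c _ => Finset.sum_congr rfl fun b _ => by ring
  have hint : ∀ c b, Integrable (fun D : n → m → ℂ => B b c * (star (D d c) * D a b))
      (stdCGaussMat n m) := fun c b => ((hX d c).star.mul (hX a b)).integrable.const_mul _
  have hval : ∀ c b, ∫ D : n → m → ℂ, B b c * (star (D d c) * D a b) ∂stdCGaussMat n m
      = B b c * if d = a ∧ c = b then 1 else 0 := by
    intro c b
    rw [integral_const_mul, integral_two_coord_stdCGaussMat (d, c) (a, b)]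
    simp only [Prod.mk.injEq]
  simp only [hexp]
  rw [integral_finsetSum _ fun c _ => integrable_finsetSum _ fun b _ => hint c b]
  simp_rw [integral_finsetSum _ fun b _ => hint _ b, hval]
  by_cases h : a = d
  · simp [h, Matrix.trace]
  · simp [h, Ne.symm h]

theorem hasAllMoments_Wmat {N L : ℕ} (β : ℝ) (S : Matrix (Fin N) (Fin N) ℂ)
    (T : Matrix (Fin L) (Fin L) ℂ) (i : Fin N) (j : Fin L) :
    HasAllMoments (stdCGaussMat (Fin N) (Fin L)) fun D => Wmat β S T D i j := by
  simp only [Wmat, Matrix.smul_apply, Matrix.mul_apply, of_apply, smul_eq_mul]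
  exact (HasAllMoments.const _).mul <| .sum _ fun b _ =>
    (HasAllMoments.sum _ fun a _ =>
      (HasAllMoments.const _).mul (hasAllMoments_coord_stdCGaussMat a b)).mul (.const _)

theorem hasAllMoments_Wmat_mul {N L : ℕ} (β : ℝ) (S : Matrix (Fin N) (Fin N) ℂ)
    (T A : Matrix (Fin L) (Fin L) ℂ) (i : Fin N) (j : Fin L) :
    HasAllMoments (stdCGaussMat (Fin N) (Fin L)) fun D => (Wmat β S T D * A) i j := by
  simp only [Matrix.mul_apply]
  exact .sum _ fun b _ => (hasAllMoments_Wmat β S T i b).mul (.const _)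

theorem hasAllMoments_Wmat_mul_conjTranspose {N L : ℕ} (β : ℝ) (S : Matrix (Fin N) (Fin N) ℂ)
    (T A : Matrix (Fin L) (Fin L) ℂ) (i j : Fin N) :
    HasAllMoments (stdCGaussMat (Fin N) (Fin L))
      fun D => (Wmat β S T D * A * (Wmat β S T D)ᴴ) i j := by
  simp only [Matrix.mul_apply, conjTranspose_apply]
  exact .sum _ fun b _ => (HasAllMoments.sum _ fun a _ =>
    (hasAllMoments_Wmat β S T i a).mul (.const _)).mul (hasAllMoments_Wmat β S T j b).star

theorem integral_Wmat_mul_conjTranspose {N L : ℕ} {β : ℝ} (hβ : 0 ≤ β)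
    {S : Matrix (Fin N) (Fin N) ℂ} {T : Matrix (Fin L) (Fin L) ℂ} (hS : S.IsHermitian)
    (hT : T.IsHermitian) (A : Matrix (Fin L) (Fin L) ℂ) (r s : Fin N) :
    ∫ D, (Wmat β S T D * A * (Wmat β S T D)ᴴ) r s ∂stdCGaussMat (Fin N) (Fin L)
      = (β : ℂ) * (T * T * A).trace * (S * S) r s := by
  have hX : ∀ (i : Fin N) (j : Fin L),
      HasAllMoments (stdCGaussMat (Fin N) (Fin L)) fun x => x i j :=
    hasAllMoments_coord_stdCGaussMat
  have hsq : (Real.sqrt β : ℂ) * (Real.sqrt β : ℂ) = β := by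
    rw [← Complex.ofReal_mul, Real.mul_self_sqrt hβ]
  have hmat : ∀ D : Fin N → Fin L → ℂ, Wmat β S T D * A * (Wmat β S T D)ᴴ
      = (β : ℂ) • (S * (Matrix.of D * (T * A * T) * (Matrix.of D)ᴴ) * S) := by
    intro D
    rw [← hsq]
    have hconj : star (Real.sqrt β : ℂ) = Real.sqrt β := Complex.conj_ofReal _
    simp only [Wmat, conjTranspose_smul, conjTranspose_mul, hS.eq, hT.eq, Matrix.smul_mul,
      Matrix.mul_smul, smul_smul, hconj, Matrix.mul_assoc]
  have hexp : ∀ D : Fin N → Fin L → ℂ, (Wmat β S T D * A * (Wmat β S T D)ᴴ) r s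
      = ∑ d, ∑ a, (β * S r a * S d s) *
          (Matrix.of D * (T * A * T) * (Matrix.of D)ᴴ) a d := by
    intro D
    rw [hmat, Matrix.smul_apply, Matrix.mul_apply, smul_eq_mul, Finset.mul_sum]
    refine Finset.sum_congr rfl fun d _ => ?_
    rw [Matrix.mul_apply, Finset.sum_mul, Finset.mul_sum]
    exact Finset.sum_congr rfl fun a _ => by ring
  have hD : ∀ a d, Integrable
      (fun D : Fin N → Fin L → ℂ => (Matrix.of D * (T * A * T) * (Matrix.of D)ᴴ) a d)
      (stdCGaussMat (Fin N) (Fin L)) := by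
    intro a d
    simp only [Matrix.mul_apply, conjTranspose_apply, of_apply]
    exact (HasAllMoments.sum _ fun c _ => (HasAllMoments.sum _ fun b _ =>
      (hX _ _).mul (.const _)).mul (hX _ _).star).integrable
  simp only [hexp]
  rw [integral_finsetSum _ fun d _ => integrable_finsetSum _ fun a _ => (hD a d).const_mul _]
  simp_rw [integral_finsetSum _ fun a _ => (hD a _).const_mul _, integral_const_mul,
    integral_mul_conjTranspose_stdCGaussMat]
  have htr : (T * A * T).trace = (T * T * A).trace := by
    rw [trace_mul_comm, Matrix.mul_assoc]
  simp only [mul_ite, mul_zero, Finset.sum_ite_eq', Finset.mem_univ, if_true, htr]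
  rw [Matrix.mul_apply, Finset.mul_sum]
  exact Finset.sum_congr rfl fun a _ => by ring

theorem dotProduct_estimate_expansion {n m : Type} [Fintype n] [Fintype m]
    (W : Matrix n m ℂ) (A : Matrix m m ℂ) (u v : n → ℂ) (z : m → ℂ) (a : ℂ) :
    star (Wᴴ *ᵥ u) ⬝ᵥ (a • (A *ᵥ (a • (Wᴴ *ᵥ v) + z)))
      = ∑ t : (n × n) ⊕ (n × m),
        Sum.elim (fun q => a * a * (W * A * Wᴴ) q.1 q.2) (fun q => a * (W * A) q.1 q.2) t *
        Sum.elim (fun q => star (u q.1) * v q.2) (fun q => star (u q.1)) t *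
        Sum.elim (fun _ => 1) (fun q => z q.2) t := by
  have h : star (Wᴴ *ᵥ u) ⬝ᵥ (a • (A *ᵥ (a • (Wᴴ *ᵥ v) + z)))
      = a * a * (star u ⬝ᵥ ((W * A * Wᴴ) *ᵥ v)) + a * (star u ⬝ᵥ ((W * A) *ᵥ z)) := by
    rw [star_mulVec, conjTranspose_conjTranspose, ← dotProduct_mulVec]
    simp only [mulVec_smul, mulVec_add, mulVec_mulVec, dotProduct_smul, dotProduct_add, smul_eq_mul,
      Matrix.mul_assoc]
    ring
  rw [h, Fintype.sum_sum_type]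
  simp only [Sum.elim_inl, Sum.elim_inr, Fintype.sum_prod_type]
  simp only [dotProduct, mulVec, Finset.mul_sum, Pi.star_apply]
  congr 1 <;>
    exact Finset.sum_congr rfl fun _ _ => Finset.sum_congr rfl fun _ _ => by ring

theorem integral_sum_mul_star_sum {T α₁ α₂ α₃ α₄ α₅ : Type} [Fintype T]
    [MeasurableSpace α₁] [MeasurableSpace α₂] [MeasurableSpace α₃] [MeasurableSpace α₄]
    [MeasurableSpace α₅] (ν₁ : Measure α₁) (ν₂ : Measure α₂) (ν₃ : Measure α₃)
    (ν₄ : Measure α₄) (ν₅ : Measure α₅) [IsProbabilityMeasure ν₁] [IsProbabilityMeasure ν₂]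
    [IsProbabilityMeasure ν₃] [IsProbabilityMeasure ν₄] [IsProbabilityMeasure ν₅]
    (f₁ : T → α₁ → ℂ) (f₂ : T → α₂ → ℂ) (f₃ : T → α₃ → ℂ) (f₄ : T → α₄ → ℂ) (f₅ : T → α₅ → ℂ)
    (h₁ : ∀ t, HasAllMoments ν₁ (f₁ t)) (h₂ : ∀ t, HasAllMoments ν₂ (f₂ t))
    (h₃ : ∀ t, HasAllMoments ν₃ (f₃ t)) (h₄ : ∀ t, HasAllMoments ν₄ (f₄ t))
    (h₅ : ∀ t, HasAllMoments ν₅ (f₅ t)) :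
    Integrable (fun x : α₁ × α₂ × α₃ × α₄ × α₅ =>
        (∑ t, f₁ t x.1 * f₃ t x.2.2.1 * f₄ t x.2.2.2.1) *
          star (∑ t, f₂ t x.2.1 * f₃ t x.2.2.1 * f₅ t x.2.2.2.2))
        (ν₁.prod (ν₂.prod (ν₃.prod (ν₄.prod ν₅)))) ∧
    ∫ x, (∑ t, f₁ t x.1 * f₃ t x.2.2.1 * f₄ t x.2.2.2.1) *
        star (∑ t, f₂ t x.2.1 * f₃ t x.2.2.1 * f₅ t x.2.2.2.2)
        ∂(ν₁.prod (ν₂.prod (ν₃.prod (ν₄.prod ν₅))))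
      = ∑ t, ∑ t', (∫ x, f₁ t x ∂ν₁) * (star (∫ x, f₂ t' x ∂ν₂) *
          ((∫ x, f₃ t x * star (f₃ t' x) ∂ν₃) *
            ((∫ x, f₄ t x ∂ν₄) * star (∫ x, f₅ t' x ∂ν₅)))) := by
  have hexp : ∀ x : α₁ × α₂ × α₃ × α₄ × α₅,
      (∑ t, f₁ t x.1 * f₃ t x.2.2.1 * f₄ t x.2.2.2.1) *
        star (∑ t, f₂ t x.2.1 * f₃ t x.2.2.1 * f₅ t x.2.2.2.2)
      = ∑ t, ∑ t', f₁ t x.1 * (star (f₂ t' x.2.1) * ((f₃ t x.2.2.1 * star (f₃ t' x.2.2.1)) *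
          (f₄ t x.2.2.2.1 * star (f₅ t' x.2.2.2.2)))) := by
    intro x
    rw [star_sum, Finset.sum_mul_sum]
    refine Finset.sum_congr rfl fun t _ => Finset.sum_congr rfl fun t' _ => ?_
    simp only [star_mul']
    ring
  have hint : ∀ t t', Integrable (fun x : α₁ × α₂ × α₃ × α₄ × α₅ =>
      f₁ t x.1 * (star (f₂ t' x.2.1) * ((f₃ t x.2.2.1 * star (f₃ t' x.2.2.1)) *
          (f₄ t x.2.2.2.1 * star (f₅ t' x.2.2.2.2)))))
      (ν₁.prod (ν₂.prod (ν₃.prod (ν₄.prod ν₅)))) := fun t t' =>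
    (h₁ t).integrable.mul_prod <| (h₂ t').star.integrable.mul_prod <|
      ((h₃ t).mul (h₃ t').star).integrable.mul_prod <|
        (h₄ t).integrable.mul_prod (h₅ t').star.integrable
  have hstar : ∀ {α : Type} [MeasurableSpace α] (ν : Measure α) (f : α → ℂ),
      ∫ x, star (f x) ∂ν = star (∫ x, f x ∂ν) := fun ν f => integral_conj
  simp only [hexp]
  refine ⟨integrable_finsetSum _ fun t _ => integrable_finsetSum _ fun t' _ => hint t t', ?_⟩
  rw [integral_finsetSum _ fun t _ => integrable_finsetSum _ fun t' _ => hint t t']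
  refine Finset.sum_congr rfl fun t _ => ?_
  rw [integral_finsetSum _ fun t' _ => hint t t']
  refine Finset.sum_congr rfl fun t' _ => ?_
  rw [integral_prod_mul (f₁ t) (fun y : α₂ × α₃ × α₄ × α₅ =>
      star (f₂ t' y.1) * ((f₃ t y.2.1 * star (f₃ t' y.2.1)) *
        (f₄ t y.2.2.1 * star (f₅ t' y.2.2.2)))),
    integral_prod_mul (fun x => star (f₂ t' x)) (fun y : α₃ × α₄ × α₅ =>
      (f₃ t y.1 * star (f₃ t' y.1)) * (f₄ t y.2.1 * star (f₅ t' y.2.2))),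
    integral_prod_mul (fun x => f₃ t x * star (f₃ t' x)) (fun y : α₄ × α₅ =>
      f₄ t y.1 * star (f₅ t' y.2)),
    integral_prod_mul (f₄ t) (fun x => star (f₅ t' x)), hstar, hstar]

theorem isHermitian_mul_self {n : Type} [Fintype n] {S : Matrix n n ℂ} (hS : S.IsHermitian) :
    (S * S).IsHermitian := by
  rw [Matrix.IsHermitian, conjTranspose_mul, hS.eq]

/-- The amplitude of the phase-shifted RIS–UE channel, `Φ q = (√β · Φ S) c`. -/
noncomputable def risGain {N : ℕ} (β : ℝ) (Φ S : Matrix (Fin N) (Fin N) ℂ) :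
    Matrix (Fin N) (Fin N) ℂ :=
  (Real.sqrt β : ℂ) • (Φ * S)

theorem hChan_eq_mulVec_risGain {N L : ℕ} (βm : ℝ) (S : Matrix (Fin N) (Fin N) ℂ)
    (T : Matrix (Fin L) (Fin L) ℂ) (Φ : Matrix (Fin N) (Fin N) ℂ) (β : ℝ)
    (Su : Matrix (Fin N) (Fin N) ℂ) (D : Fin N → Fin L → ℂ) (c : Fin N → ℂ) :
    hChan βm S T Φ β Su D c = (Wmat βm S T D)ᴴ *ᵥ (risGain β Φ Su *ᵥ c) := by
  rw [hChan, qVec, risGain, mulVec_smul, mulVec_mulVec, smul_mulVec]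

theorem risGain_mul_conjTranspose {N : ℕ} {β : ℝ} (hβ : 0 ≤ β) (Φ : Matrix (Fin N) (Fin N) ℂ)
    {S : Matrix (Fin N) (Fin N) ℂ} (hS : S.IsHermitian) :
    risGain β Φ S * (risGain β Φ S)ᴴ = (β : ℂ) • (Φ * (S * S) * Φᴴ) := by
  have hsq : (Real.sqrt β : ℂ) * (Real.sqrt β : ℂ) = β := by
    rw [← Complex.ofReal_mul, Real.mul_self_sqrt hβ]
  have hconj : star (Real.sqrt β : ℂ) = Real.sqrt β := Complex.conj_ofReal _
  rw [← hsq]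
  simp only [risGain, conjTranspose_smul, conjTranspose_mul, hS.eq, Matrix.smul_mul,
    Matrix.mul_smul, smul_smul, hconj, Matrix.mul_assoc]

theorem Rtil_eq_risGain {N : ℕ} (βm : ℝ) {β : ℝ} (hβ : 0 ≤ β) (R Φ : Matrix (Fin N) (Fin N) ℂ)
    {S : Matrix (Fin N) (Fin N) ℂ} (hS : S.IsHermitian) :
    Rtil βm β R Φ (S * S) = (βm : ℂ) • (R * (risGain β Φ S * (risGain β Φ S)ᴴ)) := by
  rw [risGain_mul_conjTranspose hβ Φ hS, Rtil]
  simp only [Matrix.mul_smul, smul_smul, Matrix.mul_assoc, Complex.ofReal_mul]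

theorem star_trace_Rtil {N : ℕ} (βm : ℝ) {β : ℝ} (hβ : 0 ≤ β) {R : Matrix (Fin N) (Fin N) ℂ}
    (hR : R.IsHermitian) (Φ : Matrix (Fin N) (Fin N) ℂ) {S : Matrix (Fin N) (Fin N) ℂ}
    (hS : S.IsHermitian) :
    star (Rtil βm β R Φ (S * S)).trace = (Rtil βm β R Φ (S * S)).trace := by
  have hconj : star (βm : ℂ) = βm := Complex.conj_ofReal _
  rw [Rtil_eq_risGain βm hβ R Φ hS, trace_smul, star_smul, hconj, ← trace_conjTranspose,
    conjTranspose_mul, conjTranspose_mul, conjTranspose_conjTranspose, hR.eq, trace_mul_comm]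

theorem sum_trace_mul_trace {n : Type} [Fintype n] (A B C D : Matrix n n ℂ) :
    ∑ r, ∑ s, ∑ r', ∑ s', A r s * C s' r' * (B s r * D r' s')
      = (A * B).trace * (C * D).trace := by
  have h : (C * D).trace = ∑ r', ∑ s', C s' r' * D r' s' := by
    simp only [Matrix.trace, diag_apply, Matrix.mul_apply]
    exact Finset.sum_comm
  rw [h]
  simp only [Matrix.trace, diag_apply, Matrix.mul_apply, Finset.sum_mul]
  refine Finset.sum_congr rfl fun r _ => Finset.sum_congr rfl fun s _ => ?_
  simp only [Finset.mul_sum]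
  exact Finset.sum_congr rfl fun r' _ => Finset.sum_congr rfl fun s' _ => by ring

theorem sum_trace_four_mul {n : Type} [Fintype n] (A B C D : Matrix n n ℂ) :
    ∑ r, ∑ s, ∑ r', ∑ s', A r s * C s' r' * (D r' r * B s s')
      = (A * B * (C * D)).trace := by
  rw [show A * B * (C * D) = A * (B * C * D) by simp only [Matrix.mul_assoc]]
  simp only [Matrix.trace, diag_apply, Matrix.mul_apply, Finset.sum_mul, Finset.mul_sum]
  exact Finset.sum_congr rfl fun r _ => Finset.sum_congr rfl fun s _ =>
    Finset.sum_congr rfl fun r' _ => Finset.sum_congr rfl fun s' _ => by ring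

/-- The product `hᴴ ĥ` of a channel and its linear estimate, as a function of the random sources. -/
noncomputable def estimateCorr {N L : ℕ} {K : Type} (β : ℝ) (S : Matrix (Fin N) (Fin N) ℂ)
    (T A : Matrix (Fin L) (Fin L) ℂ) (G : K → Matrix (Fin N) (Fin N) ℂ) (Pk : Finset K) (k : K)
    (a : ℂ) (D : Fin N → Fin L → ℂ) (c : K → Fin N → ℂ) (z : Fin L → ℂ) : ℂ :=
  star ((Wmat β S T D)ᴴ *ᵥ (G k *ᵥ c k)) ⬝ᵥ
    (a • (A *ᵥ (a • ((Wmat β S T D)ᴴ *ᵥ (∑ l ∈ Pk, G l *ᵥ c l)) + z)))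

theorem integral_estimateCorr_mul_star {N L : ℕ} {K : Type} [Fintype K] {βm βn : ℝ}
    (hβm : 0 ≤ βm) (hβn : 0 ≤ βn) {Sm Sn : Matrix (Fin N) (Fin N) ℂ} (hSm : Sm.IsHermitian)
    (hSn : Sn.IsHermitian) {Tm Tn : Matrix (Fin L) (Fin L) ℂ} (hTm : Tm.IsHermitian)
    (hTn : Tn.IsHermitian) (Am An : Matrix (Fin L) (Fin L) ℂ)
    (G : K → Matrix (Fin N) (Fin N) ℂ) (Pk : Finset K) {k : K} (hk : k ∈ Pk) (a : ℂ) :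
    let ν := (stdCGaussMat (Fin N) (Fin L)).prod
      ((stdCGaussMat (Fin N) (Fin L)).prod
        ((stdCGaussMat K (Fin N)).prod ((stdCGaussPi (Fin L)).prod (stdCGaussPi (Fin L)))))
    let F := fun x : (Fin N → Fin L → ℂ) × (Fin N → Fin L → ℂ) × (K → Fin N → ℂ) ×
        (Fin L → ℂ) × (Fin L → ℂ) =>
      estimateCorr βm Sm Tm Am G Pk k a x.1 x.2.2.1 x.2.2.2.1 *
        star (estimateCorr βn Sn Tn An G Pk k a x.2.1 x.2.2.1 x.2.2.2.2)
    Integrable F ν ∧ ∫ x, F x ∂ν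
      = (a * a * (βm * (Tm * Tm * Am).trace)) * star (a * a * (βn * (Tn * Tn * An).trace)) *
        ((Sm * Sm * (G k * (G k)ᴴ)).trace * (Sn * Sn * (G k * (G k)ᴴ)).trace
          + ∑ l ∈ Pk, (Sm * Sm * (G l * (G l)ᴴ) * (Sn * Sn * (G k * (G k)ᴴ))).trace) := by
  intro ν F
  let f : ℝ → Matrix (Fin N) (Fin N) ℂ → Matrix (Fin L) (Fin L) ℂ → Matrix (Fin L) (Fin L) ℂ →
      (Fin N × Fin N) ⊕ (Fin N × Fin L) → (Fin N → Fin L → ℂ) → ℂ := fun β S T A t D =>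
    Sum.elim (fun q => a * a * (Wmat β S T D * A * (Wmat β S T D)ᴴ) q.1 q.2)
      (fun q => a * (Wmat β S T D * A) q.1 q.2) t
  let g : (Fin N × Fin N) ⊕ (Fin N × Fin L) → (K → Fin N → ℂ) → ℂ := fun t c =>
    Sum.elim (fun q => star ((G k *ᵥ c k) q.1) * (∑ l ∈ Pk, G l *ᵥ c l) q.2)
      (fun q => star ((G k *ᵥ c k) q.1)) t
  let e : (Fin N × Fin N) ⊕ (Fin N × Fin L) → (Fin L → ℂ) → ℂ := fun t z =>
    Sum.elim (fun _ => 1) (fun q => z q.2) t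
  have hF : F = fun x => (∑ t, f βm Sm Tm Am t x.1 * g t x.2.2.1 * e t x.2.2.2.1) *
      star (∑ t, f βn Sn Tn An t x.2.1 * g t x.2.2.1 * e t x.2.2.2.2) := by
    funext x
    simp only [F, estimateCorr, dotProduct_estimate_expansion, f, g, e]
  have hf : ∀ β S T A t, HasAllMoments (stdCGaussMat (Fin N) (Fin L)) (f β S T A t) := by
    rintro β S T A (q | q)
    · exact (HasAllMoments.const _).mul (hasAllMoments_Wmat_mul_conjTranspose β S T A q.1 q.2)
    · exact (HasAllMoments.const _).mul (hasAllMoments_Wmat_mul β S T A q.1 q.2)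
  have hg : ∀ t, HasAllMoments (stdCGaussMat K (Fin N)) (g t) := by
    rintro (q | q)
    · refine (hasAllMoments_mulVec_stdCGaussMat (G k) k q.1).star.mul ?_
      simp only [Finset.sum_apply]
      exact .sum _ fun l _ => hasAllMoments_mulVec_stdCGaussMat (G l) l q.2
    · exact (hasAllMoments_mulVec_stdCGaussMat (G k) k q.1).star
  have he : ∀ t, HasAllMoments (stdCGaussPi (Fin L)) (e t) := by
    rintro (q | q)
    · exact HasAllMoments.const _
    · exact hasAllMoments_coord_stdCGaussPi q.2
  have hmain := integral_sum_mul_star_sum (stdCGaussMat (Fin N) (Fin L))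
    (stdCGaussMat (Fin N) (Fin L)) (stdCGaussMat K (Fin N)) (stdCGaussPi (Fin L))
    (stdCGaussPi (Fin L)) (f βm Sm Tm Am) (f βn Sn Tn An) g e e (hf _ _ _ _) (hf _ _ _ _) hg he he
  rw [hF]
  refine ⟨hmain.1, hmain.2.trans ?_⟩
  have hf₁ : ∀ {β : ℝ} (_ : 0 ≤ β) {S : Matrix (Fin N) (Fin N) ℂ} (_ : S.IsHermitian)
      {T : Matrix (Fin L) (Fin L) ℂ} (_ : T.IsHermitian) (A : Matrix (Fin L) (Fin L) ℂ)
      (q : Fin N × Fin N), ∫ D, f β S T A (Sum.inl q) D ∂stdCGaussMat (Fin N) (Fin L)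
        = (a * a * (β * (T * T * A).trace)) * (S * S) q.1 q.2 := by
    intro β hβ S hS T hT A q
    simp only [f, Sum.elim_inl]
    rw [integral_const_mul, integral_Wmat_mul_conjTranspose hβ hS hT]
    ring
  have he₁ : ∀ q, ∫ z, e (Sum.inl q) z ∂stdCGaussPi (Fin L) = 1 := by
    intro q
    simp [e]
  have he₂ : ∀ q, ∫ z, e (Sum.inr q) z ∂stdCGaussPi (Fin L) = 0 := fun q =>
    integral_coord_stdCGaussPi q.2
  have hg₁ : ∀ q q' : Fin N × Fin N,
      ∫ c, g (Sum.inl q) c * star (g (Sum.inl q') c) ∂stdCGaussMat K (Fin N)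
        = (G k * (G k)ᴴ) q.2 q.1 * (G k * (G k)ᴴ) q'.1 q'.2
          + (G k * (G k)ᴴ) q'.1 q.1 * ∑ l ∈ Pk, (G l * (G l)ᴴ) q.2 q'.2 := by
    intro q q'
    rw [← integral_four_mulVec_stdCGaussMat G Pk hk]
    refine integral_congr_ae (.of_forall fun c => ?_)
    simp only [g, Sum.elim_inl, Finset.sum_apply, star_mul', star_star]
    ring
  have hstar : ∀ r s, star ((Sn * Sn) r s) = (Sn * Sn) s r := fun r s =>
    (isHermitian_mul_self hSn).apply s r
  simp only [Fintype.sum_sum_type, he₁, he₂, hg₁, hf₁ hβm hSm hTm, hf₁ hβn hSn hTn, star_zero,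
    star_one, mul_zero, mul_one, Finset.sum_const_zero, add_zero, Fintype.sum_prod_type,
    star_mul' _ ((Sn * Sn) _ _), hstar]
  rw [← sum_trace_mul_trace (Sm * Sm) (G k * (G k)ᴴ) (Sn * Sn) (G k * (G k)ᴴ)]
  simp only [← fun l => sum_trace_four_mul (Sm * Sm) (G l * (G l)ᴴ) (Sn * Sn) (G k * (G k)ᴴ)]
  have hcomm : ∑ l ∈ Pk, ∑ r, ∑ s, ∑ r', ∑ s', (Sm * Sm) r s * (Sn * Sn) s' r' *
      ((G k * (G k)ᴴ) r' r * (G l * (G l)ᴴ) s s')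
      = ∑ r, ∑ s, ∑ r', ∑ s', ∑ l ∈ Pk, (Sm * Sm) r s * (Sn * Sn) s' r' *
      ((G k * (G k)ᴴ) r' r * (G l * (G l)ᴴ) s s') := by
    rw [Finset.sum_comm]
    refine Finset.sum_congr rfl fun r _ => ?_
    rw [Finset.sum_comm]
    refine Finset.sum_congr rfl fun s _ => ?_
    rw [Finset.sum_comm]
    refine Finset.sum_congr rfl fun r' _ => ?_
    rw [Finset.sum_comm]
  simp only [hcomm, ← Finset.sum_add_distrib, Finset.mul_sum]
  refine Finset.sum_congr rfl fun r _ => Finset.sum_congr rfl fun s _ =>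
    Finset.sum_congr rfl fun r' _ => Finset.sum_congr rfl fun s' _ => ?_
  simp only [← Finset.mul_sum]
  ring

/-- For two APs `m ≠ n`, the cross-AP coherent term satisfies
`E[h_mkᴴ ĥ_mk · ĥ_nkᴴ h_nk] = (pτ)² tr(R_AP,m R_mk Q_m) tr(R_AP,n Q_n R_nk) ·
(tr R̃_mk tr R̃_nk + tr(R̃_mk R̃_nk) + Σ_{l∈P_k\{k}} tr(R̃_ml R̃_nk))`. -/
theorem cross_AP_coherent_term
    {Ω : Type} [MeasurableSpace Ω] (μ : Measure Ω) [IsProbabilityMeasure μ]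
    (N L : ℕ) (K : Type) [Fintype K] [DecidableEq K]
    -- statistics of the two APs
    (βm βn : ℝ) (hβm : 0 < βm) (hβn : 0 < βn)
    (SRISm RRISm SRISn RRISn : Matrix (Fin N) (Fin N) ℂ)
    (hSRISm : SRISm.PosSemidef) (hRRISm : SRISm * SRISm = RRISm)
    (hSRISn : SRISn.PosSemidef) (hRRISn : SRISn * SRISn = RRISn)
    (SAPm RAPm SAPn RAPn : Matrix (Fin L) (Fin L) ℂ)
    (hSAPm : SAPm.PosSemidef) (hRAPm : SAPm * SAPm = RAPm)
    (hSAPn : SAPn.PosSemidef) (hRAPn : SAPn * SAPn = RAPn)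
    -- UE-side statistics
    (βu : K → ℝ) (hβu : ∀ l, 0 < βu l)
    (SRISu RRISu : K → Matrix (Fin N) (Fin N) ℂ)
    (hSRISu : ∀ l, (SRISu l).PosSemidef) (hRRISu : ∀ l, SRISu l * SRISu l = RRISu l)
    (Φ : K → Matrix (Fin N) (Fin N) ℂ)
    -- random sources, mutually independent standard complex Gaussians
    (Dm Dn : Ω → Fin N → Fin L → ℂ) (c : K → Ω → Fin N → ℂ)
    (zm zn : Ω → Fin L → ℂ)
    (hDm : Measurable Dm) (hDn : Measurable Dn) (hc : ∀ l, Measurable (c l))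
    (hzm : Measurable zm) (hzn : Measurable zn)
    (hlaw : μ.map (fun ω => (Dm ω, Dn ω, fun l => c l ω, zm ω, zn ω))
      = (stdCGaussMat (Fin N) (Fin L)).prod
          ((stdCGaussMat (Fin N) (Fin L)).prod
            ((stdCGaussMat K (Fin N)).prod
              ((stdCGaussPi (Fin L)).prod (stdCGaussPi (Fin L))))))
    -- pilot parameters
    (p τ : ℝ) (hp : 0 < p) (hτ : 0 < τ)
    (Pk : Finset K) (k : K) (hk : k ∈ Pk)
    -- channels, covariances, pilot observations and LMMSE objects for both APs
    (hm hn : K → Ω → Fin L → ℂ)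
    (hhm : ∀ l ω, hm l ω = hChan βm SRISm SAPm (Φ l) (βu l) (SRISu l) (Dm ω) (c l ω))
    (hhn : ∀ l ω, hn l ω = hChan βn SRISn SAPn (Φ l) (βu l) (SRISu l) (Dn ω) (c l ω))
    (Rmm Rnn : K → Matrix (Fin L) (Fin L) ℂ)
    (hRmm : ∀ l, Rmm l = (Rtil βm (βu l) RRISm (Φ l) (RRISu l)).trace • RAPm)
    (hRnn : ∀ l, Rnn l = (Rtil βn (βu l) RRISn (Φ l) (RRISu l)).trace • RAPn)
    (ym yn : Ω → Fin L → ℂ)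
    (hym : ∀ ω, ym ω = (Real.sqrt (p * τ) : ℂ) • (∑ l ∈ Pk, hm l ω) + zm ω)
    (hyn : ∀ ω, yn ω = (Real.sqrt (p * τ) : ℂ) • (∑ l ∈ Pk, hn l ω) + zn ω)
    (Qm Qn : Matrix (Fin L) (Fin L) ℂ)
    (hQm : Qm = (((p * τ : ℝ) : ℂ) • (∑ l ∈ Pk, Rmm l) + 1)⁻¹)
    (hQn : Qn = (((p * τ : ℝ) : ℂ) • (∑ l ∈ Pk, Rnn l) + 1)⁻¹)
    (hhatm hhatn : Ω → Fin L → ℂ)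
    (hhatm_def : ∀ ω, hhatm ω = (Real.sqrt (p * τ) : ℂ) • ((Rmm k * Qm) *ᵥ ym ω))
    (hhatn_def : ∀ ω, hhatn ω = (Real.sqrt (p * τ) : ℂ) • ((Rnn k * Qn) *ᵥ yn ω)) :
    (∫ ω, (star (hm k ω) ⬝ᵥ hhatm ω) * (star (hhatn ω) ⬝ᵥ hn k ω) ∂μ)
      = ((p * τ : ℝ) : ℂ) ^ 2 * (RAPm * Rmm k * Qm).trace * (RAPn * Qn * Rnn k).trace *
          ((Rtil βm (βu k) RRISm (Φ k) (RRISu k)).trace *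
              (Rtil βn (βu k) RRISn (Φ k) (RRISu k)).trace
            + (Rtil βm (βu k) RRISm (Φ k) (RRISu k) *
                Rtil βn (βu k) RRISn (Φ k) (RRISu k)).trace
            + ∑ l ∈ Pk.erase k,
                (Rtil βm (βu l) RRISm (Φ l) (RRISu l) *
                  Rtil βn (βu k) RRISn (Φ k) (RRISu k)).trace) := by
  have hSm := hSRISm.isHermitian
  have hSn := hSRISn.isHermitian
  have hTm := hSAPm.isHermitian
  have hTn := hSAPn.isHermitian
  have hSu := fun l => (hSRISu l).isHermitian
  subst hRRISm hRRISn hRAPm hRAPn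
  obtain rfl : (fun l => SRISu l * SRISu l) = RRISu := funext hRRISu
  set a : ℂ := (Real.sqrt (p * τ) : ℂ) with ha
  have haa : a * a = ((p * τ : ℝ) : ℂ) := by
    rw [ha, ← Complex.ofReal_mul, Real.mul_self_sqrt (mul_pos hp hτ).le]
  have hreal : ∀ x : ℝ, star (x : ℂ) = x := fun x => Complex.conj_ofReal x
  let G := fun l => risGain (βu l) (Φ l) (SRISu l)
  have hcorr : ∀ (β : ℝ) (S : Matrix (Fin N) (Fin N) ℂ) (T A : Matrix (Fin L) (Fin L) ℂ)
      (D : Fin N → Fin L → ℂ) (c : K → Fin N → ℂ) (z : Fin L → ℂ),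
      star (hChan β S T (Φ k) (βu k) (SRISu k) D (c k)) ⬝ᵥ
        (a • (A *ᵥ (a • (∑ l ∈ Pk, hChan β S T (Φ l) (βu l) (SRISu l) D (c l)) + z)))
      = estimateCorr β S T A G Pk k a D c z := by
    intro β S T A D c z
    simp only [hChan_eq_mulVec_risGain, estimateCorr, G, mulVec_sum]
  have hX : ∀ ω, star (hm k ω) ⬝ᵥ hhatm ω = estimateCorr βm SRISm SAPm (Rmm k * Qm) G Pk k a
      (Dm ω) (fun l => c l ω) (zm ω) := by
    intro ω
    simp only [hhatm_def, hym, hhm, ← hcorr]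
  have hY : ∀ ω, star (hhatn ω) ⬝ᵥ hn k ω = star (estimateCorr βn SRISn SAPn (Rnn k * Qn) G Pk k a
      (Dn ω) (fun l => c l ω) (zn ω)) := by
    intro ω
    have h : star (hhatn ω) ⬝ᵥ hn k ω = star (star (hn k ω) ⬝ᵥ hhatn ω) := by
      simp [dotProduct, mul_comm]
    rw [h]
    simp only [hhatn_def, hyn, hhn, ← hcorr]
  obtain ⟨hint, hval⟩ := integral_estimateCorr_mul_star hβm.le hβn.le hSm hSn hTm hTn
    (Rmm k * Qm) (Rnn k * Qn) G Pk hk a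
  have hφ : Measurable fun ω => (Dm ω, Dn ω, fun l => c l ω, zm ω, zn ω) :=
    hDm.prodMk (hDn.prodMk ((measurable_pi_lambda _ hc).prodMk (hzm.prodMk hzn)))
  rw [← hlaw] at hint hval
  rw [integral_map hφ.aemeasurable hint.aestronglyMeasurable] at hval
  simp only [hX, hY]
  rw [hval]
  have hRnnH : ∀ l, (Rnn l).IsHermitian := by
    intro l
    rw [hRnn, Matrix.IsHermitian, conjTranspose_smul, (isHermitian_mul_self hTn).eq,
      star_trace_Rtil βn (hβu l).le (isHermitian_mul_self hSn) (Φ l) (hSu l)]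
  have hQnH : Qn.IsHermitian := by
    rw [hQn]
    refine IsHermitian.inv ?_
    rw [Matrix.IsHermitian, conjTranspose_add, conjTranspose_smul, conjTranspose_sum, hreal,
      conjTranspose_one]
    simp only [fun l => (hRnnH l).eq]
  have htn : star (SAPn * SAPn * (Rnn k * Qn)).trace = (SAPn * SAPn * Qn * Rnn k).trace := by
    rw [← trace_conjTranspose, conjTranspose_mul, conjTranspose_mul, (hRnnH k).eq, hQnH.eq,
      (isHermitian_mul_self hTn).eq, trace_mul_comm]
    simp only [Matrix.mul_assoc]
  have hRt : ∀ (β : ℝ) (R : Matrix (Fin N) (Fin N) ℂ) l,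
      Rtil β (βu l) R (Φ l) (SRISu l * SRISu l) = (β : ℂ) • (R * (G l * (G l)ᴴ)) :=
    fun β R l => Rtil_eq_risGain β (hβu l).le R (Φ l) (hSu l)
  simp only [hRt, haa, star_mul', hreal, htn, Matrix.mul_assoc (SAPm * SAPm) (Rmm k) Qm]
  rw [← Finset.add_sum_erase Pk _ hk]
  simp only [trace_smul, Matrix.smul_mul, Matrix.mul_smul, smul_eq_mul, ← Finset.mul_sum]
  ring
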